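/- For every integer r and every λ ∈ Λ²V*, one has p₂!( m_r*(ω) ∧ m*(λ) ) = (r−1)²·λ and p₂!( m_r*(λ) ∧ m*(ω) ) = (r−1)²·λ in Λ²V*. (These are the remaining two intersection-theoretic identities on A×A used in the proof of Proposition 'split' in Section 4.) -/

import Mathlib

/-!
Model: `V4 = Fin 4 → ℝ` plays the role of `V*` (so `Λ•V* = ExteriorAlgebra ℝ V4`),
with basis `f 0, …, f 3` (the `fⱼ*`), point class `ωA = f₁*∧f₂*∧f₃*∧f₄*`.
`Λ•(V₁* ⊕ V₂*) = ExteriorAlgebra ℝ (V4 × V4)`, with `pull₁, pull₂` the algebra maps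
induced by the two inclusions, and `mPull r` the algebra map induced by `ξ ↦ (ξ, r·ξ)`
(pullback under `m_r : A×A → A`).  The pushforward `p₂!` is taken to be any linear
map satisfying its defining properties.
-/

noncomputable section

open ExteriorAlgebra

abbrev V4 : Type := Fin 4 → ℝ

def f (i : Fin 4) : V4 := Pi.single i 1

/-- the point class `ω = f₁*∧f₂*∧f₃*∧f₄*` -/
def ωA : ExteriorAlgebra ℝ V4 :=
  ι ℝ (f 0) * ι ℝ (f 1) * ι ℝ (f 2) * ι ℝ (f 3)

/-- pullback `p₁*` under the first projection -/
def pull₁ : ExteriorAlgebra ℝ V4 →ₐ[ℝ] ExteriorAlgebra ℝ (V4 × V4) :=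
  ExteriorAlgebra.map (LinearMap.inl ℝ V4 V4)

/-- pullback `p₂*` under the second projection -/
def pull₂ : ExteriorAlgebra ℝ V4 →ₐ[ℝ] ExteriorAlgebra ℝ (V4 × V4) :=
  ExteriorAlgebra.map (LinearMap.inr ℝ V4 V4)

/-- pullback `m_r*` under `m_r : A×A → A, (a,b) ↦ a + r·b`, induced by `ξ ↦ (ξ, r·ξ)` -/
def mPull (r : ℤ) : ExteriorAlgebra ℝ V4 →ₐ[ℝ] ExteriorAlgebra ℝ (V4 × V4) :=
  ExteriorAlgebra.map (LinearMap.inl ℝ V4 V4 + (r : ℝ) • LinearMap.inr ℝ V4 V4)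

/-- product of first-factor one-forms -/
def xProd (l : List V4) : ExteriorAlgebra ℝ (V4 × V4) :=
  (l.map fun v => pull₁ (ι ℝ v)).prod

/-- span of the terms of degree `< k` in the first factor -/
def lowF (k : ℕ) : Submodule ℝ (ExteriorAlgebra ℝ (V4 × V4)) :=
  Submodule.span ℝ {z | ∃ l : List V4, l.length < k ∧ ∃ β, z = xProd l * pull₂ β}

lemma pull₁_ι (v : V4) : pull₁ (ι ℝ v) = ι ℝ (v, 0) := by
  simp [pull₁]

lemma pull₂_ι (v : V4) : pull₂ (ι ℝ v) = ι ℝ (0, v) := by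
  simp [pull₂]

lemma mPull_ι (s : ℤ) (v : V4) :
    mPull s (ι ℝ v) = pull₁ (ι ℝ v) + (s : ℝ) • pull₂ (ι ℝ v) := by
  rw [pull₁_ι, pull₂_ι, ← map_smul, ← map_add]
  simp [mPull]

lemma ι_anti {M : Type*} [AddCommGroup M] [Module ℝ M] (x y : M) :
    ι ℝ x * ι ℝ y = -(ι ℝ y * ι ℝ x) :=
  eq_neg_of_add_eq_zero_left (ι_add_mul_swap x y)

lemma y_mul_xProd (w : V4) (l : List V4) :
    pull₂ (ι ℝ w) * xProd l = (-1 : ℝ) ^ l.length • (xProd l * pull₂ (ι ℝ w)) := by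
  induction l with
  | nil => simp [xProd]
  | cons v l ih =>
    have h : xProd (v :: l) = pull₁ (ι ℝ v) * xProd l := by simp [xProd]
    have h2 : pull₂ (ι ℝ w) * pull₁ (ι ℝ v) = -(pull₁ (ι ℝ v) * pull₂ (ι ℝ w)) := by
      rw [pull₁_ι, pull₂_ι, ι_anti]
    rw [h, ← mul_assoc, h2, neg_mul, mul_assoc, ih, List.length_cons, pow_succ]
    simp [mul_assoc]

lemma xProd_eq (l : List V4) : xProd l = pull₁ (l.map fun v => ι ℝ v).prod := by
  simp [xProd, map_list_prod, Function.comp_def]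

lemma ιprod_mem (l : List V4) : (l.map fun v => ι ℝ v).prod ∈ ⋀[ℝ]^l.length V4 := by
  induction l with
  | nil => simp
  | cons v l ih =>
    rw [List.map_cons, List.prod_cons, List.length_cons, exteriorPower, pow_succ']
    exact Submodule.mul_mem_mul ⟨v, rfl⟩ ih

lemma lowF_mul {k : ℕ} {z} (hz : z ∈ lowF k) (β : ExteriorAlgebra ℝ V4) :
    z * pull₂ β ∈ lowF k := by
  induction hz using Submodule.span_induction with
  | mem z h =>
    obtain ⟨l, hl, β', rfl⟩ := h
    exact Submodule.subset_span ⟨l, hl, β' * β, by rw [map_mul, mul_assoc]⟩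
  | zero => simp
  | add a b _ _ ha hb => rw [add_mul]; exact add_mem ha hb
  | smul c a _ ha => rw [smul_mul_assoc]; exact Submodule.smul_mem _ _ ha

lemma x_mul_lowF {k : ℕ} {z} (hz : z ∈ lowF k) (v : V4) :
    pull₁ (ι ℝ v) * z ∈ lowF (k + 1) := by
  induction hz using Submodule.span_induction with
  | mem z h =>
    obtain ⟨l, hl, β', rfl⟩ := h
    exact Submodule.subset_span ⟨v :: l, by simpa using hl, β', by simp [xProd, mul_assoc]⟩
  | zero => simp
  | add a b _ _ ha hb => rw [mul_add]; exact add_mem ha hb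
  | smul c a _ ha => rw [mul_smul_comm]; exact Submodule.smul_mem _ _ ha

lemma y_mul_lowF {k : ℕ} {z} (hz : z ∈ lowF k) (v : V4) :
    pull₂ (ι ℝ v) * z ∈ lowF (k + 1) := by
  induction hz using Submodule.span_induction with
  | mem z h =>
    obtain ⟨l, hl, β', rfl⟩ := h
    rw [← mul_assoc, y_mul_xProd, smul_mul_assoc]
    exact Submodule.smul_mem _ _
      (Submodule.subset_span ⟨l, by omega, ι ℝ v * β', by rw [map_mul, mul_assoc]⟩)
  | zero => simp
  | add a b _ _ ha hb => rw [mul_add]; exact add_mem ha hb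
  | smul c a _ ha => rw [mul_smul_comm]; exact Submodule.smul_mem _ _ ha

lemma mPull_expand (s : ℤ) (l : List V4) :
    mPull s (l.map fun v => ι ℝ v).prod - xProd l ∈ lowF l.length := by
  induction l with
  | nil => simp [xProd]
  | cons v l ih =>
    have h : xProd (v :: l) = pull₁ (ι ℝ v) * xProd l := by simp [xProd]
    have hx : pull₂ (ι ℝ v) * xProd l ∈ lowF (l.length + 1) := by
      rw [y_mul_xProd]
      exact Submodule.smul_mem _ _ (Submodule.subset_span ⟨l, by omega, _, rfl⟩)
    rw [List.map_cons, List.prod_cons, List.length_cons, map_mul, mPull_ι, h]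
    generalize mPull s (l.map fun v => ι ℝ v).prod = Z at ih
    have e : (pull₁ (ι ℝ v) + (s : ℝ) • pull₂ (ι ℝ v)) * Z - pull₁ (ι ℝ v) * xProd l
        = pull₁ (ι ℝ v) * (Z - xProd l) + ((s : ℝ) • (pull₂ (ι ℝ v) * (Z - xProd l))
          + (s : ℝ) • (pull₂ (ι ℝ v) * xProd l)) := by
      simp only [add_mul, mul_sub, smul_mul_assoc, smul_sub]
      abel
    rw [e]
    exact add_mem (x_mul_lowF ih v) (add_mem (Submodule.smul_mem _ _ (y_mul_lowF ih v))
      (Submodule.smul_mem _ _ hx))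

lemma ωA_eq : ωA = (([f 0, f 1, f 2, f 3] : List V4).map fun v => ι ℝ v).prod := by
  simp [ωA, mul_assoc]

lemma push_mω (s : ℤ)
    (push : ExteriorAlgebra ℝ (V4 × V4) →ₗ[ℝ] ExteriorAlgebra ℝ V4)
    (hpushω : ∀ β : ExteriorAlgebra ℝ V4, push (pull₁ ωA * pull₂ β) = β)
    (hpushlow : ∀ k : ℕ, k < 4 → ∀ γ ∈ ⋀[ℝ]^k V4,
      ∀ β : ExteriorAlgebra ℝ V4, push (pull₁ γ * pull₂ β) = 0)
    (β : ExteriorAlgebra ℝ V4) : push (mPull s ωA * pull₂ β) = β := by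
  have hlow : ∀ z ∈ lowF 4, push z = 0 := by
    intro z hz
    induction hz using Submodule.span_induction with
    | mem z h =>
      obtain ⟨l, hl, β', rfl⟩ := h
      rw [xProd_eq]
      exact hpushlow _ hl _ (ιprod_mem l) _
    | zero => simp
    | add a b _ _ ha hb => rw [map_add, ha, hb, add_zero]
    | smul c a _ ha => rw [map_smul, ha, smul_zero]
  have h := hlow _ (lowF_mul (mPull_expand s [f 0, f 1, f 2, f 3]) β)
  rw [xProd_eq, ← ωA_eq, sub_mul, map_sub, hpushω, sub_eq_zero] at h
  exact h

lemma ω_comm {M : Type*} [AddCommGroup M] [Module ℝ M] (a b c d v : M) :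
    ι ℝ a * ι ℝ b * ι ℝ c * ι ℝ d * ι ℝ v = ι ℝ v * (ι ℝ a * ι ℝ b * ι ℝ c * ι ℝ d) := by
  rw [mul_assoc, ι_anti d v, mul_neg, ← mul_assoc, mul_assoc _ (ι ℝ c), ι_anti c v, mul_neg,
    ← mul_assoc, mul_assoc _ (ι ℝ b), ι_anti b v, mul_neg, ← mul_assoc, ι_anti a v]
  simp [mul_assoc]

lemma ι_mul_ω (v : V4) : ι ℝ v * ωA = 0 := by
  have hv : v = ∑ i, v i • f i := by
    funext j
    simp [f, Finset.sum_apply, Pi.single_apply]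
  have h : ∀ i, ι ℝ (f i) * ωA = 0 := by
    intro i
    have := ι_mul_prod_list (R := ℝ) f i
    simpa [List.ofFn_succ, ωA, mul_assoc] using this
  rw [hv, map_sum, Finset.sum_mul]
  refine Finset.sum_eq_zero fun i _ => ?_
  rw [map_smul, smul_mul_assoc, h, smul_zero]

lemma mω_comm (s : ℤ) (w : V4 × V4) : mPull s ωA * ι ℝ w = ι ℝ w * mPull s ωA := by
  simp only [ωA, mPull, map_mul, map_apply_ι]
  exact ω_comm _ _ _ _ _

lemma mω_mul (s t : ℤ) (u v : V4) :
    mPull s ωA * mPull t (ι ℝ u * ι ℝ v) =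
      ((t : ℝ) - s) ^ 2 • (mPull s ωA * pull₂ (ι ℝ u * ι ℝ v)) := by
  have hm : ∀ v, mPull t (ι ℝ v) = mPull s (ι ℝ v) + ((t : ℝ) - s) • pull₂ (ι ℝ v) := by
    intro v
    rw [mPull_ι, mPull_ι, sub_smul]
    abel
  have h0 : ∀ v, mPull s ωA * mPull s (ι ℝ v) = 0 := by
    intro v
    have h1 : mPull s (ι ℝ v) * mPull s ωA = 0 := by rw [← map_mul, ι_mul_ω, map_zero]
    rw [← h1]
    simp only [mPull, map_apply_ι]
    exact mω_comm s _
  have ha : pull₂ (ι ℝ u) * mPull s (ι ℝ v) = -(mPull s (ι ℝ v) * pull₂ (ι ℝ u)) := by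
    simp only [mPull, pull₂, map_apply_ι]
    exact ι_anti _ _
  rw [map_mul, map_mul, hm u, hm v, ← mul_assoc, mul_add (mPull s ωA), h0, zero_add, mul_smul_comm,
    smul_mul_assoc, mul_assoc, mul_add, ha, mul_add, mul_neg, ← mul_assoc _ (mPull s (ι ℝ v)), h0,
    zero_mul, neg_zero, zero_add, mul_smul_comm, mul_smul_comm, smul_smul, sq]

lemma mω_comm2 (s t : ℤ) (u v : V4) :
    mPull t (ι ℝ u * ι ℝ v) * mPull s ωA = mPull s ωA * mPull t (ι ℝ u * ι ℝ v) := by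
  have h : ∀ v, mPull t (ι ℝ v) * mPull s ωA = mPull s ωA * mPull t (ι ℝ v) := by
    intro v
    have : mPull t (ι ℝ v) = ι ℝ ((LinearMap.inl ℝ V4 V4 + (t : ℝ) • LinearMap.inr ℝ V4 V4) v) := by
      simp only [mPull, map_apply_ι]
    rw [this, mω_comm]
  rw [map_mul, mul_assoc, h, ← mul_assoc, h, mul_assoc]

/-- `p₂!(m_r*ω ∧ m*λ) = (r−1)²·λ` and `p₂!(m_r*λ ∧ m*ω) = (r−1)²·λ`. -/
theorem stmt2 (r : ℤ)
    -- `p₂! : Λ•(V₁*⊕V₂*) → Λ•V*`, integration over the first factor: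
    (push : ExteriorAlgebra ℝ (V4 × V4) →ₗ[ℝ] ExteriorAlgebra ℝ V4)
    (hpushω : ∀ β : ExteriorAlgebra ℝ V4, push (pull₁ ωA * pull₂ β) = β)
    (hpushlow : ∀ k : ℕ, k < 4 → ∀ γ ∈ ⋀[ℝ]^k V4,
      ∀ β : ExteriorAlgebra ℝ V4, push (pull₁ γ * pull₂ β) = 0)
    -- the 2-form `λ`:
    (lam : ExteriorAlgebra ℝ V4) (hlam : lam ∈ ⋀[ℝ]^2 V4) :
    push (mPull r ωA * mPull 1 lam) = (((r : ℝ) - 1) ^ 2) • lam ∧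
    push (mPull r lam * mPull 1 ωA) = (((r : ℝ) - 1) ^ 2) • lam := by
  have key : ∀ u v : V4,
      push (mPull r ωA * mPull 1 (ι ℝ u * ι ℝ v)) = (((r : ℝ) - 1) ^ 2) • (ι ℝ u * ι ℝ v) ∧
      push (mPull r (ι ℝ u * ι ℝ v) * mPull 1 ωA) = (((r : ℝ) - 1) ^ 2) • (ι ℝ u * ι ℝ v) := by
    intro u v
    constructor
    · rw [mω_mul, map_smul, push_mω r push hpushω hpushlow]
      congr 1
      push_cast
      ring
    · rw [mω_comm2, mω_mul, map_smul, push_mω 1 push hpushω hpushlow]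
      congr 1
      push_cast
      ring
  rw [exteriorPower, pow_two] at hlam
  induction hlam using Submodule.mul_induction_on' with
  | mem_mul_mem a ha b hb =>
    obtain ⟨u, rfl⟩ := ha
    obtain ⟨v, rfl⟩ := hb
    exact key u v
  | add a _ b _ ha hb =>
    simp only [map_add, mul_add, add_mul, smul_add, ha.1, ha.2, hb.1, hb.2, and_self]
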